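/- There exists a constant C > 0, independent of K and ν, such that for every ν > 0, every K ≥ 2, every smooth vector field u : 𝕋³ → ℝ³, and every measurable θ : 𝕋³ → [1,∞) with θ ∈ L²(𝕋³), one has K ∫_{𝕋³} θ^{−1/K} |∇u|³ dx ≤ (νK/3) ∫_{𝕋³} θ^{(K−1)/K} |∇²u|² dx + (ν/12) ∫_{𝕋³} θ^{−(K+1)/K} |∇u|⁴ dx + C (K⁸/ν¹¹) ‖θ‖_{L²(𝕋³)}^{(7K−5)/K}. -/

import Mathlib

open MeasureTheory Real
open scoped ENNReal

noncomputable section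

/-- Points of `ℝ³`; `ℤ³`-periodic functions on `Sp` model functions on the torus `𝕋³`. -/
abbrev Sp : Type := Fin 3 → ℝ

/-- A fundamental cell for the torus `𝕋³ = ℝ³/ℤ³`; integrals over `𝕋³` are integrals
over `cell`. -/
def cell : Set Sp := Set.Icc 0 1

/-- The `i`-th partial derivative `∂ᵢ f`. -/
def pd (i : Fin 3) (f : Sp → ℝ) (x : Sp) : ℝ := fderiv ℝ f x (Pi.single i 1)

/-- `ℤ³`-periodicity: such a function descends to the torus `𝕋³`. -/
def Periodic3 (f : Sp → ℝ) : Prop :=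
  ∀ (x : Sp) (k : Fin 3 → ℤ), f (x + fun i => (k i : ℝ)) = f x

/-- `|∇u|²` for a vector field `u`. -/
def gradSqV (u : Sp → Fin 3 → ℝ) (x : Sp) : ℝ :=
  ∑ i, ∑ j, (pd i (fun y => u y j) x) ^ 2

/-- `|∇²u|²` for a vector field `u`. -/
def hessSqV (u : Sp → Fin 3 → ℝ) (x : Sp) : ℝ :=
  ∑ i, ∑ j, ∑ k, (pd i (pd j (fun y => u y k)) x) ^ 2

/-- `|∇f|²` for a scalar field `f`. -/
def gradSqS (f : Sp → ℝ) (x : Sp) : ℝ := ∑ i, (pd i f x) ^ 2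

theorem Periodic3.pd {f : Sp → ℝ} (hf : Periodic3 f) (i : Fin 3) : Periodic3 (pd i f) := by
  intro x k
  have h : (fun y => f (y + fun i => (k i : ℝ))) = f := funext fun y => hf y k
  unfold _root_.pd
  rw [← fderiv_comp_add_right, h]

theorem Periodic3.gradSqS {f : Sp → ℝ} (hf : Periodic3 f) : Periodic3 (gradSqS f) := by
  intro x k
  simp only [_root_.gradSqS, hf.pd _ x k]

theorem isCompact_cell : IsCompact cell := isCompact_Icc

theorem volume_cell : volume cell = 1 := by
  simp [cell, Real.volume_Icc_pi]

theorem ContinuousOn.integrableOn_cell {f : Sp → ℝ} (hf : ContinuousOn f cell) :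
    IntegrableOn f cell :=
  hf.integrableOn_compact isCompact_cell

open scoped Pointwise in
theorem setIntegral_cell_comp_add {f : Sp → ℝ} (hf : Periodic3 f) (a : Sp) :
    ∫ x in cell, f (x + a) = ∫ x in cell, f x := by
  set b := Pi.basisFun ℝ (Fin 3)
  have hD := ZSpan.isAddFundamentalDomain' b (volume : Measure Sp)
  have hcell : (ZSpan.fundamentalDomain b : Set Sp) =ᵐ[volume] cell := by
    rw [ZSpan.fundamentalDomain_pi_basisFun]
    exact Measure.univ_pi_Ico_ae_eq_Icc (f := (0 : Sp)) (g := 1)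
  have hinv : ∀ (g : (Submodule.span ℤ (Set.range b)).toAddSubgroup) (x : Sp),
      f (g +ᵥ x) = f x := by
    rintro ⟨g, hg⟩ x
    rw [Submodule.mem_toAddSubgroup, Module.Basis.mem_span_iff_repr_mem] at hg
    choose k hk using hg
    have : g = fun i => (k i : ℝ) := by
      ext i
      simpa [b] using (hk i).symm
    change f (g + x) = f x
    rw [this, add_comm, hf]
  have h1 : ∫ x in ZSpan.fundamentalDomain b, f (x + a)
      = ∫ x in a +ᵥ ZSpan.fundamentalDomain b, f x := by
    have := (measurePreserving_add_right volume a).setIntegral_preimage_emb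
      (measurableEmbedding_addRight a) f (a +ᵥ ZSpan.fundamentalDomain b)
    rw [← this]
    congr 2
    ext x
    simp [Set.mem_vadd_set_iff_neg_vadd_mem, vadd_eq_add, add_comm x a]
  have : Countable (Submodule.span ℤ (Set.range b)).toAddSubgroup :=
    inferInstanceAs (Countable (Submodule.span ℤ (Set.range b)))
  rw [← setIntegral_congr_set hcell, h1,
    (hD.vadd_of_comm a).setIntegral_eq hD hinv, setIntegral_congr_set hcell]

theorem setIntegral_swap {X Y : Type*} [TopologicalSpace X] [TopologicalSpace Y]
    [MeasurableSpace X] [MeasurableSpace Y] [OpensMeasurableSpace (X × Y)]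
    {μ : Measure X} {ν : Measure Y} [SFinite μ] [SFinite ν]
    [IsFiniteMeasureOnCompacts (μ.prod ν)] [T2Space (X × Y)]
    {s : Set X} {t : Set Y} (hs : IsCompact s) (ht : IsCompact t)
    {F : X → Y → ℝ} (hF : Continuous (Function.uncurry F)) :
    ∫ x in s, ∫ y in t, F x y ∂ν ∂μ = ∫ y in t, ∫ x in s, F x y ∂μ ∂ν := by
  apply integral_integral_swap
  rw [Measure.prod_restrict]
  exact hF.continuousOn.integrableOn_compact (hs.prod ht)

theorem ContDiff.continuous_pd {f : Sp → ℝ} (hf : ContDiff ℝ 1 f) (i : Fin 3) :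
    Continuous (pd i f) :=
  (hf.continuous_fderiv one_ne_zero).clm_apply continuous_const

theorem ContDiff.continuous_gradSqS {f : Sp → ℝ} (hf : ContDiff ℝ 1 f) :
    Continuous (gradSqS f) := by
  unfold gradSqS
  exact continuous_finsetSum _ fun i _ => (hf.continuous_pd i).pow 2

theorem fderiv_apply_eq_sum_pd (f : Sp → ℝ) (x z : Sp) :
    fderiv ℝ f x z = ∑ i, z i * pd i f x := by
  conv_lhs => rw [pi_eq_sum_univ' z]
  simp only [map_sum, map_smul, smul_eq_mul, pd]

theorem sub_eq_integral_fderiv {f : Sp → ℝ} (hf : ContDiff ℝ 1 f) (x z : Sp) :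
    f (x + z) - f x = ∫ t in Set.Icc (0 : ℝ) 1, fderiv ℝ f (x + t • z) z := by
  have hd : ∀ t : ℝ, HasDerivAt (fun t : ℝ => f (x + t • z)) (fderiv ℝ f (x + t • z) z) t := by
    intro t
    have h1 := (hf.differentiable one_ne_zero (x + t • z)).hasFDerivAt
    have h2 : HasDerivAt (fun t : ℝ => x + t • z) z t := by
      simpa using ((hasDerivAt_id t).smul_const z).const_add x
    exact h1.comp_hasDerivAt t h2
  have hc : Continuous fun t : ℝ => fderiv ℝ f (x + t • z) z :=
    ((hf.continuous_fderiv one_ne_zero).comp (by fun_prop)).clm_apply continuous_const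
  rw [integral_Icc_eq_integral_Ioc, ← intervalIntegral.integral_of_le zero_le_one,
    intervalIntegral.integral_eq_sub_of_hasDerivAt (fun t _ => hd t) (hc.intervalIntegrable _ _)]
  simp

theorem setIntegral_cell_pd {f : Sp → ℝ} (hf : ContDiff ℝ 1 f) (hp : Periodic3 f) (i : Fin 3) :
    ∫ x in cell, pd i f x = 0 := by
  have h0 : ∀ x, ∫ t in Set.Icc (0 : ℝ) 1, pd i f (x + t • Pi.single i 1) = 0 := by
    intro x
    refine (sub_eq_integral_fderiv hf x (Pi.single i 1)).symm.trans ?_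
    have h := hp x (Pi.single i 1)
    have e : (fun j => ((Pi.single i 1 : Fin 3 → ℤ) j : ℝ)) = (Pi.single i 1 : Sp) := by
      ext j
      by_cases hj : j = i <;> simp [hj]
    rw [e] at h
    linarith
  have hsw := setIntegral_swap (μ := (volume : Measure Sp)) (ν := (volume : Measure ℝ))
    isCompact_cell (isCompact_Icc (a := (0 : ℝ)) (b := 1))
    (F := fun x t => pd i f (x + t • Pi.single i 1))
    ((hf.continuous_pd i).comp (by fun_prop))
  simp only [h0, integral_zero, setIntegral_cell_comp_add (hp.pd i)] at hsw
  simpa using hsw.symm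

theorem sq_setIntegral_Icc_le {h : ℝ → ℝ} (hc : Continuous h) :
    (∫ t in Set.Icc (0 : ℝ) 1, h t) ^ 2 ≤ ∫ t in Set.Icc (0 : ℝ) 1, h t ^ 2 := by
  set m := ∫ t in Set.Icc (0 : ℝ) 1, h t
  have hi : IntegrableOn h (Set.Icc 0 1) := hc.continuousOn.integrableOn_compact isCompact_Icc
  have hi2 : IntegrableOn (fun t => h t ^ 2) (Set.Icc 0 1) :=
    (hc.pow 2).continuousOn.integrableOn_compact isCompact_Icc
  have hcst : IntegrableOn (fun _ : ℝ => m ^ 2) (Set.Icc 0 1) :=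
    continuous_const.continuousOn.integrableOn_compact isCompact_Icc
  have h0 : 0 ≤ ∫ t in Set.Icc (0 : ℝ) 1, (h t - m) ^ 2 :=
    integral_nonneg fun t => sq_nonneg _
  have h1 : ∫ t in Set.Icc (0 : ℝ) 1, (h t - m) ^ 2
      = (∫ t in Set.Icc (0 : ℝ) 1, h t ^ 2) - 2 * m * m + m ^ 2 := by
    have e : ∀ t, (h t - m) ^ 2 = h t ^ 2 - 2 * m * h t + m ^ 2 := fun t => by ring
    simp only [e]
    have hsub : IntegrableOn (fun t => h t ^ 2 - 2 * m * h t) (Set.Icc 0 1) :=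
      hi2.sub (hi.const_mul (2 * m))
    rw [integral_add hsub hcst,
      integral_sub hi2 (hi.const_mul (2 * m)),
      integral_const_mul]
    simp [m]
  nlinarith

/-- Poincaré's inequality on the torus. -/
theorem setIntegral_cell_sq_le {f : Sp → ℝ} (hf : ContDiff ℝ 1 f) (hp : Periodic3 f)
    (h0 : ∫ x in cell, f x = 0) :
    ∫ x in cell, f x ^ 2 ≤ 3 / 2 * ∫ x in cell, gradSqS f x := by
  have hfc := hf.continuous
  have hGc := hf.continuous_gradSqS
  have hint : ∀ {g : Sp → ℝ}, Continuous g → IntegrableOn g cell := fun hg =>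
    hg.continuousOn.integrableOn_cell
  have key : ∀ z ∈ cell, 2 * (∫ x in cell, f x ^ 2) - 2 * (∫ x in cell, f (x + z) * f x)
      ≤ 3 * ∫ x in cell, gradSqS f x := by
    intro z hz
    have hpt : ∀ x, (f (x + z) - f x) ^ 2
        ≤ ∫ t in Set.Icc (0 : ℝ) 1, 3 * gradSqS f (x + t • z) := by
      intro x
      have hc : Continuous fun t : ℝ => fderiv ℝ f (x + t • z) z :=
        ((hf.continuous_fderiv one_ne_zero).comp (by fun_prop)).clm_apply continuous_const
      rw [sub_eq_integral_fderiv hf]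
      refine (sq_setIntegral_Icc_le hc).trans (integral_mono ?_ ?_ fun t => ?_)
      · exact (hc.pow 2).continuousOn.integrableOn_compact isCompact_Icc
      · exact (continuous_const.mul (hGc.comp (by fun_prop))).continuousOn.integrableOn_compact
          isCompact_Icc
      · have hz' : ∀ i, z i ^ 2 ≤ 1 := fun i => by
          have h1 := hz.1 i
          have h2 := hz.2 i
          simp only [Pi.zero_apply, Pi.one_apply] at h1 h2
          nlinarith
        simp only [fderiv_apply_eq_sum_pd, gradSqS]
        refine (Finset.sum_mul_sq_le_sq_mul_sq _ _ _).trans ?_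
        gcongr
        refine (Finset.sum_le_sum fun i _ => hz' i).trans ?_
        simp
    have hF : Continuous (Function.uncurry fun (x : Sp) (t : ℝ) => 3 * gradSqS f (x + t • z)) :=
      continuous_const.mul (hGc.comp (by fun_prop))
    have h1 : ∫ x in cell, (f (x + z) - f x) ^ 2 ≤ 3 * ∫ x in cell, gradSqS f x := by
      calc ∫ x in cell, (f (x + z) - f x) ^ 2
          ≤ ∫ x in cell, ∫ t in Set.Icc (0 : ℝ) 1, 3 * gradSqS f (x + t • z) := by
            refine integral_mono (hint (by fun_prop)) ?_ hpt
            have : Integrable (Function.uncurry fun (x : Sp) (t : ℝ) => 3 * gradSqS f (x + t • z))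
                ((volume.restrict cell).prod (volume.restrict (Set.Icc (0 : ℝ) 1))) := by
              rw [Measure.prod_restrict]
              exact hF.continuousOn.integrableOn_compact (isCompact_cell.prod isCompact_Icc)
            exact this.integral_prod_left
        _ = ∫ t in Set.Icc (0 : ℝ) 1, ∫ x in cell, 3 * gradSqS f (x + t • z) :=
            setIntegral_swap isCompact_cell isCompact_Icc hF
        _ = 3 * ∫ x in cell, gradSqS f x := by
            simp only [integral_const_mul, setIntegral_cell_comp_add hp.gradSqS]
            simp
    have h2 : ∫ x in cell, (f (x + z) - f x) ^ 2
        = 2 * (∫ x in cell, f x ^ 2) - 2 * (∫ x in cell, f (x + z) * f x) := by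
      have e : ∀ x, (f (x + z) - f x) ^ 2
          = f (x + z) ^ 2 + f x ^ 2 - 2 * (f (x + z) * f x) := fun x => by ring
      simp only [e]
      have hsq : Periodic3 fun x => f x ^ 2 := fun x k => by simp only [hp x k]
      rw [integral_sub, integral_add, integral_const_mul,
        setIntegral_cell_comp_add (f := fun x => f x ^ 2) hsq]
      · ring
      all_goals exact hint (by fun_prop)
    linarith
  have hcross : ∫ z in cell, ∫ x in cell, f (x + z) * f x = 0 := by
    rw [setIntegral_swap isCompact_cell isCompact_cell (by fun_prop)]
    have : ∀ x, ∫ z in cell, f (x + z) * f x = 0 := fun x => by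
      simp only [integral_mul_const, add_comm x, setIntegral_cell_comp_add hp, h0, zero_mul]
    simp [this]
  have hcont : IntegrableOn (fun z => ∫ x in cell, f (x + z) * f x) cell := by
    have : Integrable (Function.uncurry fun (z x : Sp) => f (x + z) * f x)
        ((volume.restrict cell).prod (volume.restrict cell)) := by
      rw [Measure.prod_restrict]
      have hc : Continuous (Function.uncurry fun (z x : Sp) => f (x + z) * f x) := by fun_prop
      exact hc.continuousOn.integrableOn_compact (isCompact_cell.prod isCompact_cell)
    exact this.integral_prod_left
  have hreal : volume.real cell = 1 := by simp [Measure.real, volume_cell]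
  have := setIntegral_mono_on (s := cell)
    (f := fun z => 2 * (∫ x in cell, f x ^ 2) - 2 * ∫ x in cell, f (x + z) * f x)
    (((hint continuous_const).sub (hcont.const_mul 2)))
    (hint continuous_const) isCompact_cell.measurableSet key
  rw [integral_sub (hint continuous_const) (hcont.const_mul 2),
    integral_const_mul 2 (fun z => ∫ x in cell, f (x + z) * f x), hcross,
    setIntegral_const, setIntegral_const, hreal] at this
  simp only [smul_eq_mul] at this
  linarith

theorem setIntegral_closedBall_le_setIntegral_cell {F : Sp → ℝ} (hF : Continuous F)
    (hp : Periodic3 F) (h0 : ∀ x, 0 ≤ F x) :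
    ∫ x in Metric.closedBall (fun _ => 1 / 2 : Sp) (3 / 2), F x ≤ 27 * ∫ x in cell, F x := by
  let a : (Fin 3 → Fin 3) → Sp := fun k i => (((k i : ℕ) - 1 : ℤ) : ℝ)
  have hT : ∀ k, ∫ x in (fun x => x + a k) ⁻¹' cell, F x = ∫ x in cell, F x := fun k => by
    rw [← (measurePreserving_add_right volume (a k)).setIntegral_preimage_emb
      (measurableEmbedding_addRight (a k)) F cell]
    exact integral_congr_ae (.of_forall fun x => (hp x fun i => ((k i : ℕ) - 1 : ℤ)).symm)
  have hTint : ∀ k, IntegrableOn F ((fun x => x + a k) ⁻¹' cell) := fun k =>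
    hF.continuousOn.integrableOn_compact
      ((Homeomorph.addRight (a k)).isCompact_preimage.2 isCompact_cell)
  have hcover : Metric.closedBall (fun _ => 1 / 2 : Sp) (3 / 2)
      ⊆ ⋃ k, (fun x => x + a k) ⁻¹' cell := by
    intro x hx
    have hx' : ∀ i, -1 ≤ x i ∧ x i ≤ 2 := fun i => by
      have := (dist_le_pi_dist x (fun _ => 1 / 2 : Sp) i).trans hx
      rw [Real.dist_eq, abs_le] at this
      constructor <;> linarith [this.1, this.2]
    have hk : ∀ i, ∃ k : Fin 3, 0 ≤ x i + (((k : ℕ) - 1 : ℤ) : ℝ)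
        ∧ x i + (((k : ℕ) - 1 : ℤ) : ℝ) ≤ 1 := fun i => by
      obtain ⟨h1, h2⟩ := hx' i
      rcases le_total (x i) 0 with h | h
      · exact ⟨2, by norm_num; linarith, by norm_num; linarith⟩
      rcases le_total (x i) 1 with h' | h'
      · exact ⟨1, by norm_num; linarith, by norm_num; linarith⟩
      · exact ⟨0, by norm_num; linarith, by norm_num; linarith⟩
    choose k hk using hk
    exact Set.mem_iUnion.2 ⟨k, fun i => (hk i).1, fun i => (hk i).2⟩
  have hle : volume.restrict (Metric.closedBall (fun _ => 1 / 2 : Sp) (3 / 2))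
      ≤ ∑ k, volume.restrict ((fun x => x + a k) ⁻¹' cell) := by
    rw [← Measure.sum_fintype]
    exact (Measure.restrict_mono_set _ hcover).trans Measure.restrict_iUnion_le
  calc ∫ x in Metric.closedBall (fun _ => 1 / 2 : Sp) (3 / 2), F x
      ≤ ∫ x, F x ∂(∑ k, volume.restrict ((fun x => x + a k) ⁻¹' cell)) :=
        integral_mono_measure hle (.of_forall h0)
          (integrable_finsetSum_measure.2 fun k _ => hTint k)
    _ = 27 * ∫ x in cell, F x := by
        rw [integral_finsetSum_measure fun k _ => hTint k]
        simp [hT]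

theorem integrable_comp_of_hasCompactSupport {F : Type*} [NormedAddCommGroup F] {w : Sp → F}
    (hw : Continuous w) (hs : HasCompactSupport w) {g : F → ℝ} (hg : Continuous g) (h0 : g 0 = 0) :
    Integrable fun x => g (w x) :=
  (hg.comp hw).integrable_of_hasCompactSupport (hs.comp_left h0)

/-- The Gagliardo-Nirenberg-Sobolev inequality `‖v‖_{L⁶} ≲ ‖∇v‖_{L²}` in dimension three. -/
theorem exists_integral_pow_six_le : ∃ c : ℝ, 0 ≤ c ∧ ∀ v : Sp → ℝ, ContDiff ℝ 1 v →
    HasCompactSupport v → ∫ x, v x ^ 6 ≤ c * (∫ x, ‖fderiv ℝ v x‖ ^ 2) ^ 3 := by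
  set c := SNormLESNormFDerivOfEqConst ℝ (volume : Measure Sp) 2
  refine ⟨(c : ℝ) ^ 6, by positivity, fun v hv hs => ?_⟩
  have hS := eLpNorm_le_eLpNorm_fderiv_of_eq (volume : Measure Sp) hv hs (p := 2) (p' := 6)
    (by norm_num) (by simp) (by simp; norm_num)
  have hv6 : Integrable fun x => v x ^ 6 :=
    integrable_comp_of_hasCompactSupport hv.continuous hs (continuous_pow 6) (by norm_num)
  have hd2 : Integrable fun x => ‖fderiv ℝ v x‖ ^ 2 :=
    integrable_comp_of_hasCompactSupport (hv.continuous_fderiv one_ne_zero) (hs.fderiv ℝ)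
      (continuous_norm.pow 2) (by simp)
  have e6 : ENNReal.ofReal (∫ x, v x ^ 6) = eLpNorm v (6 : NNReal) volume ^ 6 := by
    have := eLpNorm_nnreal_pow_eq_lintegral (f := v) (μ := volume) (p := 6) (by norm_num)
    simp only [NNReal.coe_ofNat, ENNReal.rpow_ofNat] at this
    rw [ofReal_integral_eq_lintegral_ofReal hv6 (.of_forall fun x => by positivity)]
    rw [this]
    refine lintegral_congr fun x => ?_
    rw [← enorm_pow, Real.enorm_of_nonneg (by positivity)]
  have e2 : ENNReal.ofReal (∫ x, ‖fderiv ℝ v x‖ ^ 2)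
      = eLpNorm (fderiv ℝ v) (2 : NNReal) volume ^ 2 := by
    have := eLpNorm_nnreal_pow_eq_lintegral (f := fderiv ℝ v) (μ := volume) (p := 2) (by norm_num)
    simp only [NNReal.coe_ofNat, ENNReal.rpow_ofNat] at this
    rw [ofReal_integral_eq_lintegral_ofReal hd2 (.of_forall fun x => by positivity)]
    rw [this]
    refine lintegral_congr fun x => ?_
    rw [ENNReal.ofReal_pow (norm_nonneg _), ofReal_norm]
  have h0 : 0 ≤ ∫ x, ‖fderiv ℝ v x‖ ^ 2 := integral_nonneg fun x => by positivity
  rw [← ENNReal.ofReal_le_ofReal_iff (by positivity), ENNReal.ofReal_mul (by positivity),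
    ENNReal.ofReal_pow h0, e6, e2, ENNReal.ofReal_pow (by positivity), ENNReal.ofReal_coe_nnreal,
    ← pow_mul, ← mul_pow]
  exact pow_le_pow_left' hS 6

theorem sq_norm_fderiv_le (f : Sp → ℝ) (x : Sp) : ‖fderiv ℝ f x‖ ^ 2 ≤ 3 * gradSqS f x := by
  have h1 : ‖fderiv ℝ f x‖ ≤ ∑ i, |pd i f x| := by
    refine ContinuousLinearMap.opNorm_le_bound _ (by positivity) fun z => ?_
    rw [fderiv_apply_eq_sum_pd, Finset.sum_mul]
    refine (norm_sum_le _ _).trans (Finset.sum_le_sum fun i _ => ?_)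
    rw [norm_mul, mul_comm, Real.norm_eq_abs (pd i f x)]
    exact mul_le_mul_of_nonneg_left (norm_le_pi_norm z i) (abs_nonneg _)
  refine (pow_le_pow_left₀ (norm_nonneg _) h1 2).trans ?_
  refine (sq_sum_le_card_mul_sum_sq).trans ?_
  simp [gradSqS]

/-- The Sobolev inequality `‖f‖_{L⁶} ≲ ‖∇f‖_{L²}` for functions of mean zero on the torus. -/
theorem exists_setIntegral_cell_pow_six_le : ∃ c : ℝ, 0 ≤ c ∧ ∀ f : Sp → ℝ, ContDiff ℝ 1 f →
    Periodic3 f → ∫ x in cell, f x = 0 →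
      ∫ x in cell, f x ^ 6 ≤ c * (∫ x in cell, gradSqS f x) ^ 3 := by
  obtain ⟨c, hc0, hc⟩ := exists_integral_pow_six_le
  let χ : ContDiffBump (fun _ => 1 / 2 : Sp) := ⟨1 / 2, 3 / 2, by norm_num, by norm_num⟩
  have hχ : ContDiff ℝ 1 χ := χ.contDiff
  obtain ⟨M, hM⟩ := (hχ.continuous_fderiv one_ne_zero).bounded_above_of_compact_support
    (χ.hasCompactSupport.fderiv ℝ)
  refine ⟨c * (27 * (6 + 3 * M ^ 2)) ^ 3, by positivity, fun f hf hp h0 => ?_⟩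
  have hfc := hf.continuous
  have hGc := hf.continuous_gradSqS
  set S := Metric.closedBall (fun _ => 1 / 2 : Sp) (3 / 2)
  set v : Sp → ℝ := fun x => χ x * f x
  have hv : ContDiff ℝ 1 v := hχ.mul hf
  have hvs : HasCompactSupport v := χ.hasCompactSupport.mul_right
  have hcell : ∀ x ∈ cell, v x = f x := fun x hx => by
    have : x ∈ Metric.closedBall (fun _ => 1 / 2 : Sp) χ.rIn := by
      refine (dist_pi_le_iff (by norm_num [χ])).2 fun i => ?_
      have h1 := hx.1 i
      have h2 := hx.2 i
      simp only [Pi.zero_apply, Pi.one_apply] at h1 h2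
      rw [Real.dist_eq, abs_le]
      constructor <;> norm_num [χ] <;> linarith
    simp [v, χ.one_of_mem_closedBall this]
  have hv6 : Integrable fun x => v x ^ 6 :=
    integrable_comp_of_hasCompactSupport hv.continuous hvs (continuous_pow 6) (by norm_num)
  have h1 : ∫ x in cell, f x ^ 6 ≤ ∫ x, v x ^ 6 := by
    rw [setIntegral_congr_fun (g := fun x => v x ^ 6) isCompact_cell.measurableSet
      fun x hx => by simp only [hcell x hx]]
    exact setIntegral_le_integral hv6 (.of_forall fun x => by positivity)
  have hout : ∀ x ∉ S, ‖fderiv ℝ v x‖ ^ 2 = 0 := fun x hx => by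
    have : x ∉ tsupport v := fun h => hx <| by
      have := closure_mono (Function.support_mul_subset_left χ f) h
      rwa [← tsupport, χ.tsupport_eq] at this
    have h' := Set.notMem_subset (tsupport_fderiv_subset ℝ) this
    rw [image_eq_zero_of_notMem_tsupport h']
    simp
  have hin : ∀ x, ‖fderiv ℝ v x‖ ^ 2 ≤ 6 * gradSqS f x + 2 * M ^ 2 * f x ^ 2 := fun x => by
    have e : fderiv ℝ v x = χ x • fderiv ℝ f x + f x • fderiv ℝ χ x :=
      fderiv_mul (hχ.differentiable one_ne_zero x) (hf.differentiable one_ne_zero x)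
    have hb : ‖fderiv ℝ v x‖ ≤ ‖fderiv ℝ f x‖ + M * |f x| := by
      rw [e]
      refine (norm_add_le _ _).trans (add_le_add ?_ ?_)
      · rw [norm_smul, Real.norm_of_nonneg χ.nonneg]
        exact mul_le_of_le_one_left (norm_nonneg _) χ.le_one
      · rw [norm_smul, mul_comm, Real.norm_eq_abs]
        exact mul_le_mul_of_nonneg_right (hM x) (abs_nonneg _)
    have := sq_norm_fderiv_le f x
    have := pow_le_pow_left₀ (norm_nonneg _) hb 2
    nlinarith [sq_nonneg (‖fderiv ℝ f x‖ - M * |f x|), sq_abs (f x)]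
  have h2 : ∫ x, ‖fderiv ℝ v x‖ ^ 2
      ≤ 27 * (6 + 3 * M ^ 2) * ∫ x in cell, gradSqS f x := by
    have hFc : Continuous fun x => 6 * gradSqS f x + 2 * M ^ 2 * f x ^ 2 := by fun_prop
    have hvc := (hv.continuous_fderiv one_ne_zero).norm.pow 2
    calc ∫ x, ‖fderiv ℝ v x‖ ^ 2 = ∫ x in S, ‖fderiv ℝ v x‖ ^ 2 :=
          (setIntegral_eq_integral_of_forall_compl_eq_zero hout).symm
      _ ≤ ∫ x in S, (6 * gradSqS f x + 2 * M ^ 2 * f x ^ 2) :=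
          integral_mono (hvc.continuousOn.integrableOn_compact (isCompact_closedBall _ _))
            (hFc.continuousOn.integrableOn_compact (isCompact_closedBall _ _)) hin
      _ ≤ 27 * ∫ x in cell, (6 * gradSqS f x + 2 * M ^ 2 * f x ^ 2) :=
          setIntegral_closedBall_le_setIntegral_cell hFc
            (fun x k => by simp only [hp x k, hp.gradSqS x k])
            fun x => (sq_nonneg _).trans (hin x)
      _ = 27 * (6 * (∫ x in cell, gradSqS f x) + 2 * M ^ 2 * ∫ x in cell, f x ^ 2) := by
          rw [integral_add, integral_const_mul, integral_const_mul]
          all_goals exact ContinuousOn.integrableOn_cell (by fun_prop)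
      _ ≤ 27 * (6 + 3 * M ^ 2) * ∫ x in cell, gradSqS f x := by
          have := mul_le_mul_of_nonneg_left (setIntegral_cell_sq_le hf hp h0) (sq_nonneg M)
          linarith
  calc ∫ x in cell, f x ^ 6 ≤ c * (∫ x, ‖fderiv ℝ v x‖ ^ 2) ^ 3 := h1.trans (hc v hv hvs)
    _ ≤ c * (27 * (6 + 3 * M ^ 2) * ∫ x in cell, gradSqS f x) ^ 3 := by
        gcongr
    _ = _ := by ring

theorem ContDiff.pd {f : Sp → ℝ} {m n : WithTop ℕ∞} (hf : ContDiff ℝ n f) (hmn : m + 1 ≤ n)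
    (i : Fin 3) : ContDiff ℝ m (pd i f) :=
  (hf.fderiv_right hmn).clm_apply contDiff_const

theorem sum_pow_three_le {t : Fin 3 → ℝ} (ht : ∀ i, 0 ≤ t i) :
    (∑ i, t i) ^ 3 ≤ 9 * ∑ i, t i ^ 3 := by
  have := pow_sum_div_card_le_sum_pow (s := Finset.univ) (f := t) (fun i _ => ht i) 2
  norm_num at this
  linarith

theorem gradSqS_pd_le_hessSqV (u : Sp → Fin 3 → ℝ) (j k : Fin 3) (x : Sp) :
    gradSqS (pd j fun y => u y k) x ≤ hessSqV u x := by
  unfold gradSqS hessSqV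
  refine Finset.sum_le_sum fun i _ => ?_
  have h1 : (pd i (pd j fun y => u y k) x) ^ 2 ≤ ∑ k, (pd i (pd j fun y => u y k) x) ^ 2 :=
    Finset.single_le_sum (f := fun k => (pd i (pd j fun y => u y k) x) ^ 2)
      (fun _ _ => sq_nonneg _) (Finset.mem_univ k)
  exact h1.trans (Finset.single_le_sum
    (f := fun j => ∑ k, (pd i (pd j fun y => u y k) x) ^ 2)
    (fun _ _ => by positivity) (Finset.mem_univ j))

theorem ContDiff.continuous_gradSqV {u : Sp → Fin 3 → ℝ} (hu : ContDiff ℝ 1 u) :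
    Continuous (gradSqV u) := by
  unfold gradSqV
  exact continuous_finsetSum _ fun i _ => continuous_finsetSum _ fun j _ =>
    ((contDiff_pi.1 hu j).continuous_pd i).pow 2

theorem ContDiff.continuous_hessSqV {u : Sp → Fin 3 → ℝ} (hu : ContDiff ℝ 2 u) :
    Continuous (hessSqV u) := by
  unfold hessSqV
  exact continuous_finsetSum _ fun i _ => continuous_finsetSum _ fun j _ =>
    continuous_finsetSum _ fun k _ =>
      (((contDiff_pi.1 hu k).pd (by norm_num [one_add_one_eq_two]) j).continuous_pd i).pow 2

theorem gradSqV_nonneg (u : Sp → Fin 3 → ℝ) (x : Sp) : 0 ≤ gradSqV u x := by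
  unfold gradSqV
  positivity

theorem hessSqV_nonneg (u : Sp → Fin 3 → ℝ) (x : Sp) : 0 ≤ hessSqV u x := by
  unfold hessSqV
  positivity

/-- The Sobolev inequality `‖∇u‖_{L⁶}² ≲ ‖∇²u‖_{L²}²` on the torus. -/
theorem exists_setIntegral_cell_gradSqV_pow_three_le : ∃ c : ℝ, 1 ≤ c ∧
    ∀ u : Sp → Fin 3 → ℝ, ContDiff ℝ 2 u → (∀ j, Periodic3 fun x => u x j) →
      ∫ x in cell, gradSqV u x ^ 3 ≤ (c * ∫ x in cell, hessSqV u x) ^ 3 := by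
  obtain ⟨c, hc0, hc⟩ := exists_setIntegral_cell_pow_six_le
  refine ⟨1 + 729 * c, by linarith, fun u hu hp => ?_⟩
  set H := ∫ x in cell, hessSqV u x
  have hH : 0 ≤ H := integral_nonneg (hessSqV_nonneg u)
  have hu1 : ∀ j, ContDiff ℝ 2 fun x => u x j := contDiff_pi.1 hu
  have ha : ∀ i j, ContDiff ℝ 1 (pd i fun x => u x j) := fun i j =>
    (hu1 j).pd (by norm_num [one_add_one_eq_two]) i
  have hcomp : ∀ i j, ∫ x in cell, (pd i (fun y => u y j) x) ^ 6 ≤ c * H ^ 3 := fun i j => by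
    refine (hc _ (ha i j) ((hp j).pd i)
      (setIntegral_cell_pd ((hu1 j).of_le (by norm_num)) (hp j) i)).trans ?_
    gcongr
    · exact integral_nonneg fun x => by unfold gradSqS; positivity
    · exact integral_mono (ha i j).continuous_gradSqS.continuousOn.integrableOn_cell
        hu.continuous_hessSqV.continuousOn.integrableOn_cell (gradSqS_pd_le_hessSqV u i j)
  have hint : ∀ i j, IntegrableOn (fun x => (pd i (fun y => u y j) x) ^ 6) cell := fun i j =>
    ((ha i j).continuous.pow 6).continuousOn.integrableOn_cell
  calc ∫ x in cell, gradSqV u x ^ 3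
      ≤ ∫ x in cell, 81 * ∑ i, ∑ j, (pd i (fun y => u y j) x) ^ 6 := by
        refine integral_mono ?_ ?_ fun x => ?_
        · exact ((hu.of_le (by norm_num)).continuous_gradSqV.pow 3).continuousOn.integrableOn_cell
        · exact (integrable_finsetSum _ fun i _ => integrable_finsetSum _ fun j _ =>
            hint i j).const_mul _
        · have h1 := sum_pow_three_le (t := fun i => ∑ j, (pd i (fun y => u y j) x) ^ 2)
            fun i => by positivity
          have h2 : ∀ i, (∑ j, (pd i (fun y => u y j) x) ^ 2) ^ 3
              ≤ 9 * ∑ j, (pd i (fun y => u y j) x) ^ 6 := fun i => by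
            have := sum_pow_three_le (t := fun j => (pd i (fun y => u y j) x) ^ 2)
              fun j => by positivity
            simpa only [← pow_mul] using this
          have h3 := Finset.sum_le_sum fun i (_ : i ∈ Finset.univ) => h2 i
          rw [← Finset.mul_sum] at h3
          simp only [gradSqV]
          linarith
    _ = 81 * ∑ i, ∑ j, ∫ x in cell, (pd i (fun y => u y j) x) ^ 6 := by
        rw [integral_const_mul, integral_finsetSum _ fun i _ =>
          integrable_finsetSum _ fun j _ => hint i j]
        congr 1
        exact Finset.sum_congr rfl fun i _ => integral_finsetSum _ fun j _ => hint i j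
    _ ≤ 81 * ∑ _i : Fin 3, ∑ _j : Fin 3, c * H ^ 3 := by
        gcongr with i _ j _
        exact hcomp i j
    _ = 729 * c * H ^ 3 := by
        simp only [Finset.sum_const, Finset.card_univ, Fintype.card_fin, nsmul_eq_mul]
        push_cast
        ring
    _ ≤ (1 + 729 * c) ^ 3 * H ^ 3 := by
        gcongr
        have : 1 ≤ 1 + 729 * c := by linarith
        linarith [le_self_pow₀ this (n := 3) (by norm_num)]
    _ = _ := by ring

/-- Hölder's inequality for three functions on a probability space. -/
theorem integral_rpow_mul_rpow_mul_rpow_le {α : Type*} [MeasurableSpace α] {μ : Measure α}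
    [IsProbabilityMeasure μ] {X Y Z : α → ℝ} (hX : Integrable X μ) (hY : Integrable Y μ)
    (hZ : Integrable Z μ) (hX0 : ∀ x, 0 ≤ X x) (hY0 : ∀ x, 0 ≤ Y x) (hZ0 : ∀ x, 0 ≤ Z x)
    {a b c : ℝ} (ha : 0 ≤ a) (hb : 0 ≤ b) (hc : 0 ≤ c) (habc : a + b + c ≤ 1) :
    ∫ x, X x ^ a * Y x ^ b * Z x ^ c ∂μ
      ≤ (∫ x, X x ∂μ) ^ a * (∫ x, Y x ∂μ) ^ b * (∫ x, Z x ∂μ) ^ c := by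
  have hX' : 0 ≤ ∫ x, X x ∂μ := integral_nonneg hX0
  have hY' : 0 ≤ ∫ x, Y x ∂μ := integral_nonneg hY0
  have hZ' : 0 ≤ ∫ x, Z x ∂μ := integral_nonneg hZ0
  have hmX := hX.aestronglyMeasurable.aemeasurable
  have hmY := hY.aestronglyMeasurable.aemeasurable
  have hmZ := hZ.aestronglyMeasurable.aemeasurable
  have h := ENNReal.lintegral_prod_norm_pow_le (μ := μ) (Finset.univ : Finset (Fin 4))
    (f := ![fun x => ENNReal.ofReal (X x), fun x => ENNReal.ofReal (Y x),
      fun x => ENNReal.ofReal (Z x), 1])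
    (p := ![a, b, c, 1 - a - b - c])
    (by
      intro i _
      fin_cases i
      · exact hmX.ennreal_ofReal
      · exact hmY.ennreal_ofReal
      · exact hmZ.ennreal_ofReal
      · exact measurable_const.aemeasurable)
    (by simp [Fin.sum_univ_four])
    (by
      intro i _
      fin_cases i
      · exact ha
      · exact hb
      · exact hc
      · change 0 ≤ 1 - a - b - c
        linarith)
  simp only [Fin.prod_univ_four, Matrix.cons_val, Pi.one_apply, ENNReal.one_rpow, mul_one,
    lintegral_const, measure_univ] at h
  rw [← ofReal_integral_eq_lintegral_ofReal hX (.of_forall hX0),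
    ← ofReal_integral_eq_lintegral_ofReal hY (.of_forall hY0),
    ← ofReal_integral_eq_lintegral_ofReal hZ (.of_forall hZ0),
    ENNReal.ofReal_rpow_of_nonneg hX' ha, ENNReal.ofReal_rpow_of_nonneg hY' hb,
    ENNReal.ofReal_rpow_of_nonneg hZ' hc, ← ENNReal.ofReal_mul (by positivity),
    ← ENNReal.ofReal_mul (by positivity)] at h
  rw [integral_eq_lintegral_of_nonneg_ae]
  · refine ENNReal.toReal_le_of_le_ofReal (by positivity) (le_trans (le_of_eq ?_) h)
    refine lintegral_congr fun x => ?_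
    have := Real.rpow_nonneg (hX0 x) a
    have := Real.rpow_nonneg (hY0 x) b
    rw [ENNReal.ofReal_rpow_of_nonneg (hX0 x) ha, ENNReal.ofReal_rpow_of_nonneg (hY0 x) hb,
      ENNReal.ofReal_rpow_of_nonneg (hZ0 x) hc, ENNReal.ofReal_mul (by positivity),
      ENNReal.ofReal_mul (by positivity)]
  · exact .of_forall fun x => mul_nonneg (mul_nonneg (Real.rpow_nonneg (hX0 x) a)
      (Real.rpow_nonneg (hY0 x) b)) (Real.rpow_nonneg (hZ0 x) c)
  · exact (((hmX.pow_const a).mul (hmY.pow_const b)).mul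
      (hmZ.pow_const c)).aestronglyMeasurable

theorem le_add_add_of_pow_twelve_le {t P Q R : ℝ} (hP : 0 ≤ P) (hQ : 0 ≤ Q) (hR : 0 ≤ R)
    (h : t ^ 12 ≤ P ^ 7 * Q ^ 4 * R) : t ≤ P + Q + R := by
  refine le_of_pow_le_pow_left₀ (n := 12) (by norm_num) (by positivity) (h.trans ?_)
  calc P ^ 7 * Q ^ 4 * R ≤ (P + Q + R) ^ 7 * (P + Q + R) ^ 4 * (P + Q + R) := by
        gcongr <;> linarith
    _ = (P + Q + R) ^ 12 := by ring

theorem rpow_interpolation {θ g K : ℝ} (hθ : 1 ≤ θ) (hg : 0 ≤ g) (hK : 0 < K) :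
    θ ^ (-(1 / K)) * g ^ ((3 : ℝ) / 2)
      = (θ ^ (-((K + 1) / K)) * g ^ 2) ^ ((7 : ℝ) / 12) * (g ^ 3) ^ ((1 : ℝ) / 9)
        * (θ ^ 2) ^ ((7 * K - 5) / (24 * K)) := by
  have hθ0 : 0 < θ := by linarith
  rw [Real.mul_rpow (by positivity) (by positivity), ← Real.rpow_natCast g 2,
    ← Real.rpow_natCast g 3, ← Real.rpow_natCast θ 2, ← Real.rpow_mul hg, ← Real.rpow_mul hg,
    ← Real.rpow_mul hθ0.le, ← Real.rpow_mul hθ0.le]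
  have e1 : -(1 / K) = -((K + 1) / K) * (7 / 12) + (2 : ℕ) * ((7 * K - 5) / (24 * K)) := by
    push_cast
    field_simp
    ring
  have e2 : (3 : ℝ) / 2 = (2 : ℕ) * (7 / 12) + (3 : ℕ) * (1 / 9) := by norm_num
  rw [e1, Real.rpow_add hθ0, e2, Real.rpow_add_of_nonneg hg (by positivity) (by positivity)]
  ring

/-- **Estimate for the cubic term.** There is `C > 0` independent of `K` and `ν` such that
for every `ν > 0`, `K ≥ 2`, smooth `u` and measurable `θ ≥ 1` with `θ ∈ L²(𝕋³)`:
`K∫ θ^{−1/K}|∇u|³ ≤ (νK/3)∫ θ^{(K−1)/K}|∇²u|² + (ν/12)∫ θ^{−(K+1)/K}|∇u|⁴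
+ C(K⁸/ν¹¹)‖θ‖_{L²}^{(7K−5)/K}`. -/
theorem cubic_term_estimate :
    ∃ C : ℝ, 0 < C ∧
      ∀ ν K : ℝ, 0 < ν → 2 ≤ K →
        ∀ u : Sp → Fin 3 → ℝ, ContDiff ℝ (⊤ : ℕ∞) u →
          (∀ j, Periodic3 fun x => u x j) →
          ∀ θ : Sp → ℝ, Measurable θ → (∀ x, 1 ≤ θ x) →
            IntegrableOn (fun x => θ x ^ 2) cell volume →
            K * (∫ x in cell, θ x ^ (-(1 / K)) * gradSqV u x ^ ((3 : ℝ) / 2))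
              ≤ ν * K / 3 * (∫ x in cell, θ x ^ ((K - 1) / K) * hessSqV u x)
                + ν / 12 * (∫ x in cell, θ x ^ (-((K + 1) / K)) * (gradSqV u x) ^ 2)
                + C * (K ^ (8 : ℕ) / ν ^ (11 : ℕ))
                  * ((∫ x in cell, θ x ^ 2) ^ ((1 : ℝ) / 2)) ^ ((7 * K - 5) / K) := by
  obtain ⟨c, hc1, hc⟩ := exists_setIntegral_cell_gradSqV_pow_three_le
  refine ⟨12 ^ 7 * 81 * c ^ 4, by positivity, fun ν K hν hK u hu hp θ hθm hθ1 hθ2 => ?_⟩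
  have hK0 : 0 < K := by linarith
  have hu2 : ContDiff ℝ 2 u := contDiff_infty.1 hu 2
  have hgc := (hu2.of_le (by norm_num : (1 : WithTop ℕ∞) ≤ 2)).continuous_gradSqV
  have hhc := hu2.continuous_hessSqV
  have hg0 := gradSqV_nonneg u
  have hh0 := hessSqV_nonneg u
  have hθ0 : ∀ x, 0 < θ x := fun x => one_pos.trans_le (hθ1 x)
  have : IsProbabilityMeasure (volume.restrict cell) := ⟨by simp [volume_cell]⟩
  set A := ∫ x in cell, θ x ^ (-((K + 1) / K)) * (gradSqV u x) ^ 2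
  set H := ∫ x in cell, θ x ^ ((K - 1) / K) * hessSqV u x
  set T := ∫ x in cell, θ x ^ 2
  set J := ∫ x in cell, θ x ^ (-(1 / K)) * gradSqV u x ^ ((3 : ℝ) / 2)
  have hA0 : 0 ≤ A := integral_nonneg fun x =>
    mul_nonneg (Real.rpow_nonneg (hθ0 x).le _) (sq_nonneg _)
  have hH0 : 0 ≤ H := integral_nonneg fun x => mul_nonneg (Real.rpow_nonneg (hθ0 x).le _) (hh0 x)
  have hT0 : 0 ≤ T := integral_nonneg fun x => sq_nonneg _
  have hJ0 : 0 ≤ J := integral_nonneg fun x =>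
    mul_nonneg (Real.rpow_nonneg (hθ0 x).le _) (Real.rpow_nonneg (hg0 x) _)
  have hAint : IntegrableOn (fun x => θ x ^ (-((K + 1) / K)) * (gradSqV u x) ^ 2) cell := by
    refine Integrable.mono' (hgc.pow 2).continuousOn.integrableOn_cell
      ((hθm.pow_const _).mul (hgc.pow 2).measurable).aestronglyMeasurable (.of_forall fun x => ?_)
    rw [Real.norm_of_nonneg (mul_nonneg (Real.rpow_nonneg (hθ0 x).le _) (sq_nonneg _))]
    exact mul_le_of_le_one_left (sq_nonneg _)
      (Real.rpow_le_one_of_one_le_of_nonpos (hθ1 x) (by rw [neg_nonpos]; positivity))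
  have hexp0 : 0 ≤ (K - 1) / K := div_nonneg (by linarith) hK0.le
  have hexp2 : (K - 1) / K ≤ 2 := by rw [div_le_iff₀ hK0]; linarith
  have hHint : IntegrableOn (fun x => θ x ^ ((K - 1) / K) * hessSqV u x) cell := by
    obtain ⟨M, hM⟩ := isCompact_cell.exists_bound_of_continuousOn hhc.continuousOn
    refine Integrable.mono' (hθ2.mul_const M)
      ((hθm.pow_const _).mul hhc.measurable).aestronglyMeasurable
      (ae_restrict_of_forall_mem isCompact_cell.measurableSet fun x hx => ?_)
    rw [norm_mul, Real.norm_of_nonneg (Real.rpow_nonneg (hθ0 x).le _)]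
    refine mul_le_mul ?_ (hM x hx) (norm_nonneg _) (sq_nonneg _)
    rw [← Real.rpow_two]
    exact Real.rpow_le_rpow_of_exponent_le (hθ1 x) hexp2
  have hHle : ∫ x in cell, hessSqV u x ≤ H :=
    integral_mono hhc.continuousOn.integrableOn_cell hHint fun x =>
      le_mul_of_one_le_left (hh0 x) (Real.one_le_rpow (hθ1 x) hexp0)
  have hS : ∫ x in cell, gradSqV u x ^ 3 ≤ (c * H) ^ 3 := by
    refine (hc u hu2 hp).trans ?_
    gcongr
    exact mul_nonneg (by linarith) (integral_nonneg hh0)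
  have hexp : 0 ≤ (7 * K - 5) / (24 * K) := div_nonneg (by linarith) (by linarith)
  have hexp' : (7 * K - 5) / (24 * K) ≤ 7 / 24 := by
    rw [div_le_div_iff₀ (by linarith) (by norm_num)]
    linarith
  have hJ : J ≤ A ^ ((7 : ℝ) / 12) * (c * H) ^ ((1 : ℝ) / 3) * T ^ ((7 * K - 5) / (24 * K)) := by
    have hgint : IntegrableOn (fun x => gradSqV u x ^ 3) cell :=
      (hgc.pow 3).continuousOn.integrableOn_cell
    have h := integral_rpow_mul_rpow_mul_rpow_le hAint hgint hθ2
      (fun x => mul_nonneg (Real.rpow_nonneg (hθ0 x).le _) (sq_nonneg _))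
      (fun x => pow_nonneg (hg0 x) 3) (fun x => sq_nonneg _)
      (a := 7 / 12) (b := 1 / 9) (by norm_num) (by norm_num) hexp (by linarith)
    have e : ((c * H) ^ 3) ^ ((1 : ℝ) / 9) = (c * H) ^ ((1 : ℝ) / 3) := by
      rw [← Real.rpow_natCast, ← Real.rpow_mul (by positivity)]
      norm_num
    have hJe : J = _ := integral_congr_ae
      (.of_forall fun x => rpow_interpolation (hθ1 x) (hg0 x) hK0)
    rw [hJe]
    refine h.trans ?_
    rw [← e]
    gcongr
    exact integral_nonneg fun x => pow_nonneg (hg0 x) 3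
  have hJ12 : J ^ 12 ≤ A ^ 7 * (c * H) ^ 4 * (T ^ ((1 : ℝ) / 2)) ^ ((7 * K - 5) / K) := by
    refine (pow_le_pow_left₀ hJ0 hJ 12).trans_eq ?_
    rw [mul_pow, mul_pow]
    congr 1
    · congr 1
      · rw [← Real.rpow_natCast, ← Real.rpow_mul hA0, ← Real.rpow_natCast A]
        norm_num
      · rw [← Real.rpow_natCast, ← Real.rpow_mul (by positivity), ← Real.rpow_natCast (c * H)]
        norm_num
    · rw [← Real.rpow_natCast, ← Real.rpow_mul hT0, ← Real.rpow_mul hT0]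
      congr 1
      push_cast
      field_simp
      ring
  set R := (T ^ ((1 : ℝ) / 2)) ^ ((7 * K - 5) / K)
  have hR0 : 0 ≤ R := by positivity
  rw [add_comm (ν * K / 3 * H) (ν / 12 * A)]
  refine le_add_add_of_pow_twelve_le (by positivity) (by positivity) (by positivity) ?_
  calc (K * J) ^ 12 = K ^ 12 * J ^ 12 := mul_pow _ _ _
    _ ≤ K ^ 12 * (A ^ 7 * (c * H) ^ 4 * R) := by gcongr
    _ = _ := by
      field_simp
      ring
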